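/- arXiv:1902.10874 — 5 statements merged into one kernel-verified Lean document; each statement's English description precedes it below -/
import Mathlib

section
/- Let p > 1 be real, λ₀ ∈ ℝ, λ_M > 0 with λ₀ < p·λ_M, and C > 0. Then there exists η₀ > 0 and C′ > 0 such that for all η ∈ (0, η₀], all δ ∈ (0, η], setting T := (1/λ_M)·log(2η/δ), every continuous function f : [0,T] → [0,∞) satisfying f(t) ≤ δ·C·e^{λ_M t} + ∫₀ᵗ e^{λ₀ (t−s)} f(s)^p ds for all t ∈ [0,T] also satisfies f(t) ≤ C′·δ·e^{λ_M t} for all t ∈ [0,T]. -/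
open Set in
/-- A continuous function on `[0, T]` that satisfies `f t < g t` whenever `f < g` on `[0, t)`
stays strictly below `g`. -/
theorem lt_of_forall_lt_imp_lt {f g : ℝ → ℝ} {T : ℝ}
    (hf : ContinuousOn f (Icc 0 T)) (hg : ContinuousOn g (Icc 0 T))
    (h : ∀ t ∈ Icc 0 T, (∀ s ∈ Ico 0 t, f s < g s) → f t < g t) :
    ∀ t ∈ Icc 0 T, f t < g t := by
  by_contra! hcon
  obtain ⟨t, ht, hgt⟩ := hcon
  have hclosed : IsClosed {x | x ∈ Icc 0 T ∧ g x ≤ f x} := isClosed_Icc.isClosed_le hg hf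
  have hcompact : IsCompact {x | x ∈ Icc 0 T ∧ g x ≤ f x} :=
    isCompact_Icc.of_isClosed_subset hclosed fun x hx => hx.1
  obtain ⟨m, ⟨hm, hgm⟩, hleast⟩ := hcompact.exists_isLeast ⟨t, ht, hgt⟩
  refine absurd (h m hm fun s hs => ?_) hgm.not_gt
  by_contra! hs'
  exact (hleast ⟨⟨hs.1, hs.2.le.trans hm.2⟩, hs'⟩).not_gt hs.2

open Set in
/-- The Duhamel integral of `f ^ p` for `0 ≤ f ≤ A * exp (b * s)`, in the regime `a < p * b`. -/
theorem integral_exp_mul_rpow_le {p a b A t : ℝ} {f : ℝ → ℝ} (hp : 0 ≤ p) (hab : a < p * b)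
    (hA : 0 ≤ A) (ht : 0 ≤ t) (hf : ContinuousOn f (Icc 0 t))
    (hf0 : ∀ s ∈ Icc 0 t, 0 ≤ f s) (hfA : ∀ s ∈ Ico 0 t, f s ≤ A * Real.exp (b * s)) :
    ∫ s in (0 : ℝ)..t, Real.exp (a * (t - s)) * f s ^ p ≤
      (A * Real.exp (b * t)) ^ p / (p * b - a) := by
  have hK : 0 < p * b - a := sub_pos.2 hab
  have hpow (s : ℝ) : (A * Real.exp (b * s)) ^ p = A ^ p * Real.exp (p * b * s) := by
    rw [Real.mul_rpow hA (Real.exp_pos _).le, ← Real.exp_mul]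
    ring_nf
  have hsplit (s : ℝ) : Real.exp (a * (t - s)) * (A ^ p * Real.exp (p * b * s)) =
      A ^ p * Real.exp (a * t) * Real.exp ((p * b - a) * s) := by
    rw [mul_left_comm, mul_assoc (A ^ p), ← Real.exp_add, ← Real.exp_add]
    ring_nf
  calc ∫ s in (0 : ℝ)..t, Real.exp (a * (t - s)) * f s ^ p
      ≤ ∫ s in (0 : ℝ)..t, A ^ p * Real.exp (a * t) * Real.exp ((p * b - a) * s) := by
        refine intervalIntegral.integral_mono_on_of_le_Ioo ht ?_ ?_ fun s hs => ?_
        · refine ContinuousOn.intervalIntegrable_of_Icc ht (ContinuousOn.mul ?_ ?_)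
          · fun_prop
          · exact hf.rpow_const fun _ _ => Or.inr hp
        · exact Continuous.intervalIntegrable (by fun_prop) _ _
        · rw [← hsplit, ← hpow]
          gcongr
          · exact hf0 s (Ioo_subset_Icc_self hs)
          · exact hfA s (Ioo_subset_Ico_self hs)
    _ = A ^ p * Real.exp (a * t) * ((p * b - a)⁻¹ * (Real.exp ((p * b - a) * t) - 1)) := by
        rw [intervalIntegral.integral_const_mul,
          intervalIntegral.integral_comp_mul_left (fun x => Real.exp x) hK.ne']
        simp
    _ ≤ A ^ p * Real.exp (a * t) * ((p * b - a)⁻¹ * Real.exp ((p * b - a) * t)) := by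
        gcongr
        linarith
    _ = (A * Real.exp (b * t)) ^ p / (p * b - a) := by
        rw [hpow, div_eq_mul_inv, mul_left_comm, ← hsplit]
        simp [mul_comm]

/-- Scalar integral-inequality core of the nonlinear growth bound: if
`f(t) ≤ δ C e^{λ_M t} + ∫₀ᵗ e^{λ₀(t-s)} f(s)^p ds` on `[0,T]` with
`T = (1/λ_M) log(2η/δ)`, then `f(t) ≤ C' δ e^{λ_M t}` on `[0,T]`. -/
theorem stmt_1 (p lam0 lamM C : ℝ) (hp : 1 < p) (hlamM : 0 < lamM)
    (hspec : lam0 < p * lamM) (hC : 0 < C) :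
    ∃ η₀ : ℝ, 0 < η₀ ∧ ∃ C' : ℝ, 0 < C' ∧
      ∀ η : ℝ, 0 < η → η ≤ η₀ → ∀ δ : ℝ, 0 < δ → δ ≤ η →
        ∀ f : ℝ → ℝ,
          ContinuousOn f (Set.Icc 0 ((1 / lamM) * Real.log (2 * η / δ))) →
          (∀ t ∈ Set.Icc (0 : ℝ) ((1 / lamM) * Real.log (2 * η / δ)), 0 ≤ f t) →
          (∀ t ∈ Set.Icc (0 : ℝ) ((1 / lamM) * Real.log (2 * η / δ)),
            f t ≤ δ * C * Real.exp (lamM * t) +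
              ∫ s in (0 : ℝ)..t, Real.exp (lam0 * (t - s)) * f s ^ p) →
          ∀ t ∈ Set.Icc (0 : ℝ) ((1 / lamM) * Real.log (2 * η / δ)),
            f t ≤ C' * δ * Real.exp (lamM * t) := by
  set K := p * lamM - lam0 with hKdef
  have hK : 0 < K := sub_pos.2 hspec
  have hp' : 0 < p - 1 := sub_pos.2 hp
  refine ⟨(K / 4) ^ (1 / (p - 1)) / (4 * C), by positivity, 2 * C, by positivity, ?_⟩
  intro η hη hη₀ δ hδ _ f hf hf0 hineq t ht
  refine (lt_of_forall_lt_imp_lt (g := fun t => 2 * C * δ * Real.exp (lamM * t)) hf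
    (by fun_prop) (fun t ht hlt => ?_) t ht).le
  have hsub : Set.Icc 0 t ⊆ Set.Icc 0 ((1 / lamM) * Real.log (2 * η / δ)) :=
    Set.Icc_subset_Icc_right ht.2
  have hint := integral_exp_mul_rpow_le (A := 2 * C * δ) (zero_lt_one.trans hp).le hspec
    (by positivity) ht.1 (hf.mono hsub) (fun s hs => hf0 s (hsub hs))
    (fun s hs => (hlt s hs).le)
  have hexp : Real.exp (lamM * t) ≤ 2 * η / δ := by
    rw [← Real.le_log_iff_exp_le (by positivity)]
    have h := mul_le_mul_of_nonneg_left ht.2 hlamM.le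
    rwa [← mul_assoc, mul_one_div_cancel hlamM.ne', one_mul] at h
  set B := 2 * C * δ * Real.exp (lamM * t) with hB
  have hBpos : 0 < B := by positivity
  have hBle : B ≤ (K / 4) ^ (1 / (p - 1)) := by
    rw [le_div_iff₀ (by positivity)] at hη₀ hexp
    nlinarith
  have hBpow : B ^ (p - 1) ≤ K / 4 := by
    calc B ^ (p - 1) ≤ ((K / 4) ^ (1 / (p - 1))) ^ (p - 1) := by gcongr
      _ = K / 4 := by
        rw [← Real.rpow_mul (by positivity), one_div_mul_cancel hp'.ne', Real.rpow_one]
  have hBp : B ^ p / K ≤ B / 4 := by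
    rw [div_le_iff₀ hK]
    calc B ^ p = B ^ (p - 1) * B := by
          rw [Real.rpow_sub_one hBpos.ne', div_mul_cancel₀ _ hBpos.ne']
      _ ≤ K / 4 * B := by gcongr
      _ = B / 4 * K := by ring
  have hlin : δ * C * Real.exp (lamM * t) = B / 2 := by rw [hB]; ring
  have hmain := hineq t ht
  change f t < B
  linarith
end

section
/- Let p > 1 be real, θ > 0, λ₀ ∈ ℝ, λ_M > 0 with λ₀ + θ < (p−1)·λ_M and λ₀ < p·λ_M, and let C > 0, B₀ ≥ 0. Then there exists η₀ > 0 and C′ > 0 such that for all η ∈ (0, η₀], all δ ∈ (0, η], setting T := (1/λ_M)·log(2η/δ), every continuous function f : [0,T] → [0,∞) satisfying f(t) ≤ δ·C·e^{λ_M t} + ∫₀ᵗ e^{λ₀ (t−s)} f(s)^{p−1} ( e^{−θ s}·δ·B₀ + C ∫₀ˢ e^{−θ (s−r)} f(r) dr ) ds for all t ∈ [0,T] also satisfies f(t) ≤ C′·δ·e^{λ_M t} for all t ∈ [0,T]. -/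
theorem integral_exp_mul_le_div {a : ℝ} (ha : 0 < a) (t : ℝ) :
    ∫ s in (0 : ℝ)..t, Real.exp (a * s) ≤ Real.exp (a * t) / a := by
  have h := intervalIntegral.integral_comp_mul_left (a := (0 : ℝ)) (b := t) Real.exp ha.ne'
  rw [h, integral_exp, smul_eq_mul, mul_zero, Real.exp_zero, div_eq_inv_mul]
  exact mul_le_mul_of_nonneg_left (by linarith) (inv_nonneg.2 ha.le)

/-- An exponentially damped convolution of a function bounded by a growing exponential. -/
theorem abs_integral_exp_damped_le {θ l A s : ℝ} (hl : 0 < θ + l) (hA : 0 ≤ A)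
    (hs : 0 ≤ s) {f : ℝ → ℝ} (hf : ∀ r ∈ Set.Ioc 0 s, |f r| ≤ A * Real.exp (l * r)) :
    |∫ r in (0 : ℝ)..s, Real.exp (-θ * (s - r)) * f r| ≤ A / (θ + l) * Real.exp (l * s) := by
  have h := intervalIntegral.norm_integral_le_of_norm_le (μ := MeasureTheory.volume)
    (f := fun r => Real.exp (-θ * (s - r)) * f r)
    (g := fun r => A * Real.exp (-θ * s) * Real.exp ((θ + l) * r)) hs
    (Filter.Eventually.of_forall fun r hr => ?_)
    (Continuous.intervalIntegrable (by fun_prop) _ _)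
  · rw [Real.norm_eq_abs, intervalIntegral.integral_const_mul] at h
    refine h.trans ((mul_le_mul_of_nonneg_left (integral_exp_mul_le_div hl s)
      (by positivity)).trans_eq ?_)
    rw [show l * s = -θ * s + (θ + l) * s by ring, Real.exp_add]
    ring
  · rw [norm_mul, Real.norm_eq_abs, Real.norm_eq_abs, Real.abs_exp]
    refine (mul_le_mul_of_nonneg_left (hf r hr) (Real.exp_pos _).le).trans_eq ?_
    rw [show -θ * (s - r) = -θ * s + θ * r by ring,
      show (θ + l) * r = θ * r + l * r by ring, Real.exp_add, Real.exp_add]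
    ring

/-- The nonlinear Duhamel term is bounded when `f` grows at most like `A e^{l s}`. -/
theorem integral_duhamel_le {p θ l₀ l C b A t : ℝ} (hp : 1 < p) (hθ : 0 < θ) (hl : 0 < l)
    (hgap : l₀ < p * l) (hC : 0 < C) (hb : 0 ≤ b) (hA : 0 ≤ A) (ht : 0 ≤ t) {f : ℝ → ℝ}
    (hf₀ : ∀ s ∈ Set.Icc 0 t, 0 ≤ f s) (hf : ∀ s ∈ Set.Ico 0 t, f s ≤ A * Real.exp (l * s)) :
    ∫ s in (0 : ℝ)..t, Real.exp (l₀ * (t - s)) * f s ^ (p - 1) *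
        (Real.exp (-θ * s) * b + C * ∫ r in (0 : ℝ)..s, Real.exp (-θ * (s - r)) * f r) ≤
      (A * Real.exp (l * t)) ^ (p - 1) * ((b + C * (A / (θ + l))) / (p * l - l₀)) *
        Real.exp (l * t) := by
  have hgap' : 0 < p * l - l₀ := by linarith
  have hθl : 0 < θ + l := by linarith
  have hpow (s : ℝ) : (A * Real.exp (l * s)) ^ (p - 1) =
      A ^ (p - 1) * Real.exp (l * s * (p - 1)) := by
    rw [Real.mul_rpow hA (Real.exp_pos _).le, ← Real.exp_mul]
  have hM : 0 ≤ b + C * (A / (θ + l)) := by positivity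
  have hA' : 0 ≤ A ^ (p - 1) := Real.rpow_nonneg hA _
  generalize hMdef : b + C * (A / (θ + l)) = M at hM ⊢
  have hne : ∀ᵐ s : ℝ, s ≠ t := MeasureTheory.compl_mem_ae_iff.2 (MeasureTheory.measure_singleton t)
  have h := intervalIntegral.norm_integral_le_of_norm_le (μ := MeasureTheory.volume)
    (f := fun s => Real.exp (l₀ * (t - s)) * f s ^ (p - 1) *
        (Real.exp (-θ * s) * b + C * ∫ r in (0 : ℝ)..s, Real.exp (-θ * (s - r)) * f r))
    (g := fun s => A ^ (p - 1) * M * Real.exp (l₀ * t) * Real.exp ((p * l - l₀) * s)) ht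
    (hne.mono fun s hst hs => ?_)
    (Continuous.intervalIntegrable (by fun_prop) _ _)
  · rw [Real.norm_eq_abs, intervalIntegral.integral_const_mul] at h
    refine (le_abs_self _).trans (h.trans ((mul_le_mul_of_nonneg_left
      (integral_exp_mul_le_div hgap' t) (by positivity)).trans_eq ?_))
    have e : Real.exp (l * t * (p - 1)) * Real.exp (l * t) =
        Real.exp (l₀ * t) * Real.exp ((p * l - l₀) * t) := by
      rw [← Real.exp_add, ← Real.exp_add]
      ring_nf
    rw [hpow]
    linear_combination -(A ^ (p - 1) * M / (p * l - l₀)) * e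
  · have hlt : s < t := lt_of_le_of_ne hs.2 hst
    have hfs := hf₀ s ⟨hs.1.le, hs.2⟩
    have hinner : |∫ r in (0 : ℝ)..s, Real.exp (-θ * (s - r)) * f r| ≤
        A / (θ + l) * Real.exp (l * s) := by
      refine abs_integral_exp_damped_le hθl hA hs.1.le fun r hr => ?_
      rw [abs_of_nonneg (hf₀ r ⟨hr.1.le, hr.2.trans hs.2⟩)]
      exact hf r ⟨hr.1.le, hr.2.trans_lt hlt⟩
    have hbracket : |Real.exp (-θ * s) * b +
        C * ∫ r in (0 : ℝ)..s, Real.exp (-θ * (s - r)) * f r| ≤ M * Real.exp (l * s) := by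
      have hexp : Real.exp (-θ * s) ≤ Real.exp (l * s) :=
        Real.exp_le_exp.2 (by nlinarith [hs.1])
      refine (abs_add_le _ _).trans ?_
      rw [abs_mul, abs_mul, Real.abs_exp, abs_of_nonneg hb, abs_of_pos hC, ← hMdef]
      have h₁ := mul_le_mul_of_nonneg_right hexp hb
      have h₂ := mul_le_mul_of_nonneg_left hinner hC.le
      linarith
    have hfpow : f s ^ (p - 1) ≤ A ^ (p - 1) * Real.exp (l * s * (p - 1)) := by
      rw [← hpow]
      exact Real.rpow_le_rpow hfs (hf s ⟨hs.1.le, hlt⟩) (by linarith)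
    rw [norm_mul, norm_mul, Real.norm_eq_abs, Real.norm_eq_abs, Real.norm_eq_abs, Real.abs_exp,
      abs_of_nonneg (Real.rpow_nonneg hfs _)]
    calc _ ≤ Real.exp (l₀ * (t - s)) * (A ^ (p - 1) * Real.exp (l * s * (p - 1))) *
          (M * Real.exp (l * s)) := by gcongr
      _ = A ^ (p - 1) * M *
          (Real.exp (l₀ * (t - s)) * Real.exp (l * s * (p - 1)) * Real.exp (l * s)) := by ring
      _ = A ^ (p - 1) * M * (Real.exp (l₀ * t) * Real.exp ((p * l - l₀) * s)) := by
        rw [← Real.exp_add, ← Real.exp_add, ← Real.exp_add]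
        ring_nf
      _ = _ := by ring

/-- Continuous induction: a bound on `[0, t)` that forces the strict bound at `t` holds on all
of `[0, T]`. -/
theorem ContinuousOn.lt_of_forall_Ico_lt {f g : ℝ → ℝ} {T : ℝ}
    (hf : ContinuousOn f (Set.Icc 0 T)) (hg : ContinuousOn g (Set.Icc 0 T))
    (hstep : ∀ t ∈ Set.Icc 0 T, (∀ s ∈ Set.Ico 0 t, f s < g s) → f t < g t) :
    ∀ t ∈ Set.Icc 0 T, f t < g t := by
  by_contra! hcon
  obtain ⟨t, ht, hgt⟩ := hcon
  have hcomp : IsCompact {s ∈ Set.Icc 0 T | g s ≤ f s} :=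
    isCompact_Icc.of_isClosed_subset (isClosed_Icc.isClosed_le hg hf) (Set.sep_subset _ _)
  obtain ⟨u, hu, hmin⟩ := hcomp.exists_isLeast ⟨t, ht, hgt⟩
  refine (hstep u hu.1 fun s hs => ?_).not_ge hu.2
  by_contra! hle
  exact hs.2.not_ge (hmin ⟨⟨hs.1, hs.2.le.trans hu.1.2⟩, hle⟩)


/-- Scalar integral-inequality core of the nonlinear growth bound for dissipative
systems: if `f(t) ≤ δ C e^{λ_M t} + ∫₀ᵗ e^{λ₀(t-s)} f(s)^{p-1}
(e^{-θ s} δ B₀ + C ∫₀ˢ e^{-θ(s-r)} f(r) dr) ds` on `[0,T]` with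
`T = (1/λ_M) log(2η/δ)`, then `f(t) ≤ C' δ e^{λ_M t}` on `[0,T]`. -/
theorem stmt_2 (p θ lam0 lamM C B₀ : ℝ) (hp : 1 < p) (hθ : 0 < θ) (hlamM : 0 < lamM)
    (hspec1 : lam0 + θ < (p - 1) * lamM) (hspec2 : lam0 < p * lamM)
    (hC : 0 < C) (hB₀ : 0 ≤ B₀) :
    ∃ η₀ : ℝ, 0 < η₀ ∧ ∃ C' : ℝ, 0 < C' ∧
      ∀ η : ℝ, 0 < η → η ≤ η₀ → ∀ δ : ℝ, 0 < δ → δ ≤ η →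
        ∀ f : ℝ → ℝ,
          ContinuousOn f (Set.Icc 0 ((1 / lamM) * Real.log (2 * η / δ))) →
          (∀ t ∈ Set.Icc (0 : ℝ) ((1 / lamM) * Real.log (2 * η / δ)), 0 ≤ f t) →
          (∀ t ∈ Set.Icc (0 : ℝ) ((1 / lamM) * Real.log (2 * η / δ)),
            f t ≤ δ * C * Real.exp (lamM * t) +
              ∫ s in (0 : ℝ)..t, Real.exp (lam0 * (t - s)) * f s ^ (p - 1) *
                (Real.exp (-θ * s) * δ * B₀ +
                  C * ∫ r in (0 : ℝ)..s, Real.exp (-θ * (s - r)) * f r)) →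
          ∀ t ∈ Set.Icc (0 : ℝ) ((1 / lamM) * Real.log (2 * η / δ)),
            f t ≤ C' * δ * Real.exp (lamM * t) := by
  have hgap : 0 < p * lamM - lam0 := by linarith
  have hq : 0 < p - 1 := by linarith
  set M : ℝ := B₀ + C * (2 * C / (θ + lamM)) with hM
  have hMpos : 0 < M := by positivity
  refine ⟨(C * (p * lamM - lam0) / (2 * M)) ^ (p - 1)⁻¹ / (4 * C), by positivity,
    2 * C, by positivity, ?_⟩
  intro η hη hη₀ δ hδ _ f hf hf₀ hint
  refine fun t ht => (ContinuousOn.lt_of_forall_Ico_lt hf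
    (g := fun t => 2 * C * δ * Real.exp (lamM * t)) (by fun_prop) (fun t ht hlt => ?_) t ht).le
  have hduh := integral_duhamel_le (b := δ * B₀) hp hθ hlamM hspec2 hC (by positivity)
    (by positivity) ht.1 (fun s hs => hf₀ s ⟨hs.1, hs.2.trans ht.2⟩) fun s hs => (hlt s hs).le
  simp only [← mul_assoc (Real.exp _) δ] at hduh
  have hexp : δ * Real.exp (lamM * t) ≤ 2 * η := by
    have h₁ : lamM * t ≤ Real.log (2 * η / δ) := by
      have h₂ := mul_le_mul_of_nonneg_left ht.2 hlamM.le
      rwa [← mul_assoc, mul_one_div_cancel hlamM.ne', one_mul] at h₂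
    have h₃ := (Real.le_log_iff_exp_le (by positivity)).1 h₁
    rwa [le_div_iff₀ hδ, mul_comm] at h₃
  have hsmall : (2 * C * δ * Real.exp (lamM * t)) ^ (p - 1) ≤
      C * (p * lamM - lam0) / (2 * M) := by
    rw [le_div_iff₀ (by positivity)] at hη₀
    calc (2 * C * δ * Real.exp (lamM * t)) ^ (p - 1)
        ≤ ((C * (p * lamM - lam0) / (2 * M)) ^ (p - 1)⁻¹) ^ (p - 1) :=
          Real.rpow_le_rpow (by positivity) (by nlinarith) hq.le
      _ = _ := Real.rpow_inv_rpow (by positivity) hq.ne'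
  have hMδ : δ * B₀ + C * (2 * C * δ / (θ + lamM)) = δ * M := by
    rw [hM]
    ring
  have hbound : (2 * C * δ * Real.exp (lamM * t)) ^ (p - 1) *
      (δ * M / (p * lamM - lam0)) * Real.exp (lamM * t) ≤
      C / 2 * (δ * Real.exp (lamM * t)) := by
    calc _ ≤ C * (p * lamM - lam0) / (2 * M) *
          (δ * M / (p * lamM - lam0)) * Real.exp (lamM * t) := by gcongr
      _ = _ := by field_simp
  rw [hMδ] at hduh
  have hft := hint t ht
  have hpos : 0 < C * (δ * Real.exp (lamM * t)) := by positivity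
  show f t < 2 * C * δ * Real.exp (lamM * t)
  linarith
end

section
/- Let f : ℝ → ℂ be a Schwartz function and define f̂(ξ) := (1/(2π)) ∫_ℝ f(y) e^{−i ξ y} dy. Then for every ξ ∈ ℝ the series ∑_{j ∈ ℤ} f̂(ξ + j) e^{i j x} converges absolutely, and for every x ∈ ℝ one has f(x) = ∫_{−1/2}^{1/2} ( ∑_{j ∈ ℤ} f̂(ξ + j) e^{i j x} ) e^{i ξ x} dξ. -/
open Complex

open Set TopologicalSpace MeasureTheory Asymptotics Filter FourierTransform SchwartzMap

/-- Integer translates of a continuous function that decays like an integrable power have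
summable supremum norms on every compact set. -/
lemma summable_norm_restrict_comp_addRight (G : C(ℝ, ℂ)) {b : ℝ} (hb : 1 < b)
    (hG : G =O[cocompact ℝ] fun x : ℝ => |x| ^ (-b)) (K : Compacts ℝ) :
    Summable fun j : ℤ => ‖(G.comp (ContinuousMap.addRight (j : ℝ))).restrict K‖ :=
  summable_of_isBigO (Real.summable_abs_int_rpow hb)
    ((isBigO_norm_restrict_cocompact G (zero_lt_one.trans hb) hG K).comp_tendsto
      Int.tendsto_coe_cofinite)

lemma integral_tsum_comp_add_int_eq_integral (G : C(ℝ, ℂ)) (hint : Integrable G) {b : ℝ}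
    (hb : 1 < b) (hG : G =O[cocompact ℝ] fun x : ℝ => |x| ^ (-b)) (a : ℝ) :
    ∫ ξ in a..(a + 1), ∑' j : ℤ, G (ξ + j) = ∫ ξ, G ξ := by
  have h := intervalIntegral.hasSum_intervalIntegral_of_summable_norm (a := a) (b := a + 1)
    (summable_norm_restrict_comp_addRight G hb hG ⟨uIcc a (a + 1), isCompact_uIcc⟩)
  refine h.unique ?_
  simpa [intervalIntegral.integral_comp_add_right, add_right_comm] using
    hint.hasSum_intervalIntegral a

/-- The Fourier transform of a Schwartz function, as a function of angular frequency. -/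
noncomputable def angularFourier (f : 𝓢(ℝ, ℂ)) : 𝓢(ℝ, ℂ) :=
  SchwartzMap.compCLMOfContinuousLinearEquiv ℝ
    (ContinuousLinearEquiv.unitsEquivAut ℝ (Units.mk0 (2 * Real.pi)⁻¹ (by positivity))) (𝓕 f)

lemma angularFourier_apply (f : 𝓢(ℝ, ℂ)) (η : ℝ) :
    angularFourier f η = 𝓕 (f : ℝ → ℂ) (η / (2 * Real.pi)) := by
  rfl

lemma angularFourier_eq_integral (f : 𝓢(ℝ, ℂ)) (η : ℝ) :
    angularFourier f η = ∫ y : ℝ, f y * Complex.exp (-(Complex.I * η * y)) := by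
  rw [angularFourier_apply, Real.fourier_real_eq_integral_exp_smul]
  congr 1 with y
  rw [smul_eq_mul, mul_comm]
  congr 2
  have : (Real.pi : ℂ) ≠ 0 := by exact_mod_cast Real.pi_ne_zero
  push_cast
  field_simp

lemma eq_integral_angularFourier (f : 𝓢(ℝ, ℂ)) (x : ℝ) :
    f x = ∫ ξ : ℝ, 1 / (2 * (Real.pi : ℂ)) * angularFourier f ξ * Complex.exp (I * ξ * x) := by
  have h : 𝓕⁻ (𝓕 f : 𝓢(ℝ, ℂ)) x = f x := by rw [FourierTransform.fourierInv_fourier_eq]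
  have hpi : (0 : ℝ) < 2 * Real.pi := by positivity
  have hpi' : (Real.pi : ℂ) ≠ 0 := by exact_mod_cast Real.pi_ne_zero
  rw [← h, SchwartzMap.fourierInv_coe, Real.fourierInv_eq', SchwartzMap.fourier_coe]
  have key := Measure.integral_comp_div
    (fun v : ℝ => 1 / (2 * (Real.pi : ℂ)) * (Complex.exp (2 * Real.pi * v * x * I) *
      𝓕 (f : ℝ → ℂ) v)) (2 * Real.pi)
  rw [integral_const_mul (1 / (2 * (Real.pi : ℂ))) fun v : ℝ =>
    Complex.exp (2 * Real.pi * v * x * I) * 𝓕 (f : ℝ → ℂ) v, abs_of_pos hpi, Complex.real_smul,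
    ← mul_assoc] at key
  have hc : ((2 * Real.pi : ℝ) : ℂ) * (1 / (2 * (Real.pi : ℂ))) = 1 := by
    push_cast
    field_simp
  rw [hc, one_mul] at key
  convert key.symm using 1
  · congr 1 with v
    simp only [smul_eq_mul, RCLike.inner_apply, conj_trivial]
    congr 2
    push_cast
    ring
  · congr 1 with ξ
    rw [angularFourier_apply, mul_assoc, mul_comm (𝓕 (f : ℝ → ℂ) _)]
    congr 3
    push_cast
    field_simp

/-- Bloch decomposition of a Schwartz function on the line: with
`f̂(ξ) = (1/(2π)) ∫ f(y) e^{-iξy} dy`, the series `∑_{j∈ℤ} f̂(ξ+j) e^{ijx}` converges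
absolutely and `f(x) = ∫_{-1/2}^{1/2} (∑_{j∈ℤ} f̂(ξ+j) e^{ijx}) e^{iξx} dξ`. -/
theorem stmt_4 (f : SchwartzMap ℝ ℂ) :
    (∀ ξ x : ℝ, Summable fun j : ℤ =>
      ‖(1 / (2 * (Real.pi : ℂ))) * (∫ y : ℝ, f y * Complex.exp (-(Complex.I * (ξ + j) * y)))
        * Complex.exp (Complex.I * j * x)‖) ∧
    ∀ x : ℝ, f x =
      ∫ ξ in (-(1 / 2) : ℝ)..(1 / 2),
        (∑' j : ℤ,
          (1 / (2 * (Real.pi : ℂ))) * (∫ y : ℝ, f y * Complex.exp (-(Complex.I * (ξ + j) * y)))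
            * Complex.exp (Complex.I * j * x)) * Complex.exp (Complex.I * ξ * x) := by
  have hF (ξ : ℝ) (j : ℤ) : ∫ y : ℝ, f y * Complex.exp (-(Complex.I * (ξ + j) * y)) =
      angularFourier f (ξ + j) := by
    rw [angularFourier_eq_integral]
    push_cast
    rfl
  have hexp (η x : ℝ) : ‖Complex.exp (I * η * x)‖ = 1 := by
    rw [mul_assoc, mul_comm, ← ofReal_mul, norm_exp_ofReal_mul_I]
  have hdecay := (angularFourier f).isBigO_cocompact_rpow (-2)
  simp only [Real.norm_eq_abs] at hdecay
  simp only [hF]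
  refine ⟨fun ξ x => ?_, fun x => ?_⟩
  · have h := summable_norm_restrict_comp_addRight ⟨_, (angularFourier f).continuous⟩
      one_lt_two hdecay ⟨{ξ}, isCompact_singleton⟩
    refine (h.mul_left ‖1 / (2 * (Real.pi : ℂ))‖).of_nonneg_of_le
      (fun j => norm_nonneg _) fun j => ?_
    have he := hexp j x
    rw [ofReal_intCast] at he
    rw [norm_mul, norm_mul, he, mul_one]
    gcongr
    exact ContinuousMap.norm_coe_le_norm (ContinuousMap.restrict ({ξ} : Set ℝ)
      ((⟨_, (angularFourier f).continuous⟩ : C(ℝ, ℂ)).comp (ContinuousMap.addRight (j : ℝ))))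
      ⟨ξ, mem_singleton ξ⟩
  · let G : C(ℝ, ℂ) :=
      ⟨fun ξ => 1 / (2 * (Real.pi : ℂ)) * angularFourier f ξ * Complex.exp (I * ξ * x), by
        have := (angularFourier f).continuous
        fun_prop⟩
    have hnorm (ξ : ℝ) : ‖G ξ‖ = ‖1 / (2 * (Real.pi : ℂ)) * angularFourier f ξ‖ := by
      change ‖_ * Complex.exp (I * ξ * x)‖ = _
      rw [norm_mul, hexp, mul_one]
    have hint : Integrable G :=
      ((angularFourier f).integrable.const_mul (1 / (2 * (Real.pi : ℂ)))).congr'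
        G.continuous.aestronglyMeasurable (ae_of_all _ fun ξ => (hnorm ξ).symm)
    have hG : G =O[cocompact ℝ] fun x : ℝ => |x| ^ (-2 : ℝ) :=
      (isBigO_of_le _ fun ξ => (hnorm ξ).le).trans (hdecay.const_mul_left _)
    have h := integral_tsum_comp_add_int_eq_integral G hint one_lt_two hG (-(1 / 2))
    rw [show (-(1 / 2) + 1 : ℝ) = 1 / 2 by norm_num] at h
    refine ((eq_integral_angularFourier f x).trans h.symm).trans ?_
    congr 1 with ξ
    rw [← tsum_mul_right]
    congr 1 with j
    change _ * Complex.exp (I * (ξ + j : ℝ) * x) = _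
    rw [mul_assoc _ (Complex.exp _) (Complex.exp _), ← Complex.exp_add]
    congr 2
    push_cast
    ring
end

section
/- Let f : ℝ → ℂ be a Schwartz function and define f̂(ξ) := (1/(2π)) ∫_ℝ f(y) e^{−i ξ y} dy. Then ∫_ℝ |f(x)|² dx = 2π ∫_{−1/2}^{1/2} ( ∑_{j ∈ ℤ} |f̂(ξ + j)|² ) dξ. -/
open MeasureTheory FourierTransform

theorem MeasureTheory.Integrable.hasSum_setIntegral_comp_add_int
    {E : Type*} [NormedAddCommGroup E] [NormedSpace ℝ E]
    {g : ℝ → E} (hg : Integrable g) (a : ℝ) :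
    HasSum (fun j : ℤ => ∫ x in Set.Ioc a (a + 1), g (x + j)) (∫ x, g x) := by
  simp_rw [← intervalIntegral.integral_of_le (le_add_of_nonneg_right (zero_le_one' ℝ)),
    intervalIntegral.integral_comp_add_right, add_right_comm a 1]
  exact hg.hasSum_intervalIntegral a

/-- Unfolding: integrating the periodization of an integrable function over a unit interval
recovers its integral over the line. -/
theorem MeasureTheory.Integrable.intervalIntegral_tsum_comp_add_int
    {E : Type*} [NormedAddCommGroup E] [NormedSpace ℝ E]
    {g : ℝ → E} (hg : Integrable g) (a : ℝ) :
    ∫ x in a..a + 1, ∑' j : ℤ, g (x + j) = ∫ x, g x := by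
  rw [intervalIntegral.integral_of_le (by linarith), ← integral_tsum_of_summable_integral_norm]
  · exact (hg.hasSum_setIntegral_comp_add_int a).tsum_eq
  · exact fun j => (hg.comp_add_right (j : ℝ)).integrableOn
  · exact (hg.norm.hasSum_setIntegral_comp_add_int a).summable

/-- The Fourier transform in the angular frequency convention, in terms of `𝓕`. -/
theorem Real.integral_mul_exp_neg_I_mul_eq_fourier (f : ℝ → ℂ) (ξ : ℝ) :
    ∫ y : ℝ, f y * Complex.exp (-(Complex.I * ξ * y)) = 𝓕 f (ξ / (2 * Real.pi)) := by
  rw [Real.fourier_real_eq_integral_exp_smul]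
  congr 1 with y
  rw [smul_eq_mul, mul_comm]
  congr 2
  push_cast
  field_simp

/-- Parseval identity for the Bloch transform: with
`f̂(ξ) = (1/(2π)) ∫ f(y) e^{-iξy} dy`, one has
`∫ |f|² = 2π ∫_{-1/2}^{1/2} ∑_{j∈ℤ} |f̂(ξ+j)|² dξ`. -/
theorem stmt_5 (f : SchwartzMap ℝ ℂ) :
    (∫ x : ℝ, ‖f x‖ ^ 2) =
      2 * Real.pi *
        ∫ ξ in (-(1 / 2) : ℝ)..(1 / 2),
          ∑' j : ℤ,
            ‖(1 / (2 * (Real.pi : ℂ))) *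
              (∫ y : ℝ, f y * Complex.exp (-(Complex.I * (ξ + j) * y)))‖ ^ 2 := by
  have hint : Integrable fun ξ : ℝ => ‖𝓕 f ξ‖ ^ 2 :=
    ((𝓕 f).memLp 2).integrable_norm_pow two_ne_zero
  have hterm (ξ : ℝ) (j : ℤ) :
      ‖(1 / (2 * (Real.pi : ℂ))) *
        (∫ y : ℝ, f y * Complex.exp (-(Complex.I * (ξ + j) * y)))‖ ^ 2 =
      (1 / (2 * Real.pi)) ^ 2 * ‖𝓕 f ((ξ + j) / (2 * Real.pi))‖ ^ 2 := by
    have h := Real.integral_mul_exp_neg_I_mul_eq_fourier f (ξ + j)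
    push_cast at h
    rw [h, norm_mul, mul_pow, SchwartzMap.fourier_coe]
    simp [abs_of_pos Real.pi_pos]
  have hunfold := ((hint.comp_div Real.two_pi_pos.ne').const_mul
    ((1 / (2 * Real.pi)) ^ 2)).intervalIntegral_tsum_comp_add_int (-(1 / 2))
  rw [show (-(1 / 2) + 1 : ℝ) = 1 / 2 by norm_num] at hunfold
  simp_rw [hterm]
  rw [hunfold, integral_const_mul,
    Measure.integral_comp_div (fun ξ : ℝ => ‖𝓕 f ξ‖ ^ 2), SchwartzMap.integral_norm_sq_fourier,
    abs_of_pos Real.two_pi_pos, smul_eq_mul]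
  field_simp
end

section
/- Let u : ℝ → ℝ be a Schwartz function and β > 0. Then ∫_ℝ u(x) u'(x) ( u''''(x) − u''(x) ) dx ≤ (1/2) ‖u‖_{L^∞} [ (1 + (1/β) ‖u‖_{L^∞}) ∫_ℝ (u'(x))² dx + ∫_ℝ (u''(x))² dx ] + (β/2) ∫_ℝ (u''''(x))² dx. -/
open MeasureTheory in
/-- The square of an iterated derivative of a Schwartz function is integrable. -/
theorem SchwartzMap.integrable_sq_iteratedDeriv (u : SchwartzMap ℝ ℝ) (n : ℕ) :
    Integrable (fun x : ℝ => (iteratedDeriv n (⇑u) x) ^ 2) := by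
  obtain ⟨g, hg⟩ : ∃ g : SchwartzMap ℝ ℝ, ⇑g = iteratedDeriv n (⇑u) := by
    induction n with
    | zero => exact ⟨u, iteratedDeriv_zero.symm⟩
    | succ n ih =>
      obtain ⟨g, hg⟩ := ih
      refine ⟨SchwartzMap.derivCLM ℝ ℝ g, ?_⟩
      ext x
      rw [SchwartzMap.derivCLM_apply, iteratedDeriv_succ, hg]
  rw [← hg]
  exact (g.memLp 2).integrable_sq

/-- Young's inequality for the product `a * b * (d - c)`, where `|a| ≤ M`. -/
theorem abs_mul_mul_sub_le_of_abs_le {a b c d M β : ℝ} (hβ : 0 < β) (ha : |a| ≤ M) :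
    |a * b * (d - c)| ≤
      1 / 2 * M * ((1 + 1 / β * M) * b ^ 2 + c ^ 2) + β / 2 * d ^ 2 := by
  have hM : 0 ≤ M := (abs_nonneg a).trans ha
  have hbc : |b| * |c| ≤ (b ^ 2 + c ^ 2) / 2 := by
    nlinarith [sq_nonneg (|b| - |c|), sq_abs b, sq_abs c]
  have hbd : M * |b| * |d| ≤ M ^ 2 * b ^ 2 / (2 * β) + β / 2 * d ^ 2 := by
    have h : M ^ 2 * b ^ 2 / (2 * β) + β / 2 * d ^ 2 - M * |b| * |d| =
        (M * |b| - β * |d|) ^ 2 / (2 * β) := by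
      rw [← sq_abs b, ← sq_abs d]
      field_simp
      ring
    have : 0 ≤ (M * |b| - β * |d|) ^ 2 / (2 * β) := by positivity
    linarith
  calc |a * b * (d - c)| = |a| * |b| * |d - c| := by rw [abs_mul, abs_mul]
    _ ≤ M * |b| * (|d| + |c|) := by gcongr; exact abs_sub d c
    _ = M * |b| * |d| + M * (|b| * |c|) := by ring
    _ ≤ M ^ 2 * b ^ 2 / (2 * β) + β / 2 * d ^ 2 + M * ((b ^ 2 + c ^ 2) / 2) := by gcongr
    _ = _ := by field_simp; ring

/-- Bound on the contribution of the quadratic nonlinearity `u u_x` to the `H²` energy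
estimate: `∫ u u' (u'''' - u'') ≤ (1/2)‖u‖_∞ [(1 + ‖u‖_∞/β) ∫ (u')² + ∫ (u'')²]
+ (β/2) ∫ (u'''')²`. -/
theorem stmt_10 (u : SchwartzMap ℝ ℝ) (β : ℝ) (hβ : 0 < β) :
    (∫ x : ℝ, u x * deriv (⇑u) x * (iteratedDeriv 4 (⇑u) x - iteratedDeriv 2 (⇑u) x)) ≤
      (1 / 2) * (⨆ x : ℝ, |u x|) *
          ((1 + (1 / β) * (⨆ x : ℝ, |u x|)) * (∫ x : ℝ, (deriv (⇑u) x) ^ 2) +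
            (∫ x : ℝ, (iteratedDeriv 2 (⇑u) x) ^ 2)) +
        (β / 2) * (∫ x : ℝ, (iteratedDeriv 4 (⇑u) x) ^ 2) := by
  set M := ⨆ x : ℝ, |u x|
  have hM (x : ℝ) : |u x| ≤ M :=
    le_ciSup (f := fun x => |u x|)
      ⟨_, Set.forall_mem_range.2 fun y => u.norm_le_seminorm ℝ y⟩ x
  have h1 := u.integrable_sq_iteratedDeriv 1
  have h2 := u.integrable_sq_iteratedDeriv 2
  have h4 := u.integrable_sq_iteratedDeriv 4
  rw [iteratedDeriv_one] at h1
  have hb := h1.const_mul (1 + 1 / β * M)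
  have hc : MeasureTheory.Integrable fun x : ℝ =>
      1 / 2 * M * ((1 + 1 / β * M) * deriv (⇑u) x ^ 2 + iteratedDeriv 2 (⇑u) x ^ 2) :=
    (hb.add h2).const_mul _
  have hd := h4.const_mul (β / 2)
  refine (Real.le_norm_self _).trans ((MeasureTheory.norm_integral_le_of_norm_le (hc.add hd)
    (.of_forall fun x => abs_mul_mul_sub_le_of_abs_le hβ (hM x))).trans_eq ?_)
  rw [MeasureTheory.integral_add' hc hd, MeasureTheory.integral_const_mul,
    MeasureTheory.integral_add hb h2, MeasureTheory.integral_const_mul,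
    MeasureTheory.integral_const_mul]
end
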